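/- The evolutionary graph on V={0,1,2} with weights w(0,1)=w(0,2)=1/2, w(1,0)=w(2,0)=3/4, w(1,2)=w(2,1)=1/4 (and all other weights 0) is not isothermal (indeed w(1,0)+w(2,0)=3/2≠1), yet for every r>1 the discrete-time Moran process with fitness r on this evolutionary graph, started from a single initial mutant placed at a uniformly random vertex, has fixation probability exactly r²/(r²+r+1), which equals (1−1/r)/(1−1/r³). -/

import Mathlib

open Finset

/-- Total fitness of the mutant set `S` (mutants have fitness `r`, non-mutants fitness `1`). -/
noncomputable def moranW {V : Type*} [Fintype V] (r : ℝ) (S : Finset V) : ℝ :=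
  r * S.card + ((Fintype.card V : ℝ) - S.card)

/-- One-step transition probability of the Moran process with fitness `r` and
reproduction weights `w`, from mutant set `S` to mutant set `T`:  a vertex `u` is chosen
with probability `r / moranW r S` if it is a mutant and `1 / moranW r S` otherwise, then a
target `v` is chosen with probability `w u v`, and `v` becomes a mutant if `u` is one and
a non-mutant otherwise. -/
noncomputable def moranStep {V : Type*} [Fintype V] [DecidableEq V]
    (r : ℝ) (w : V → V → ℝ) (S T : Finset V) : ℝ :=
  ∑ u : V, ∑ v : V,
    ((if u ∈ S then r else 1) / moranW r S) * w u v *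
      (if (if u ∈ S then insert v S else S.erase v) = T then 1 else 0)

/-- Distribution of the Moran process after `t` steps, from initial distribution `init`. -/
noncomputable def moranDist {V : Type*} [Fintype V] [DecidableEq V]
    (r : ℝ) (w : V → V → ℝ) (init : Finset V → ℝ) : ℕ → Finset V → ℝ
  | 0 => init
  | t + 1 => fun T => ∑ S : Finset V, moranDist r w init t S * moranStep r w S T

/-- Reproduction weights of the (unweighted) Moran process on the digraph with
out-neighbourhoods `out`: the offspring goes to a uniformly random out-neighbour. -/
noncomputable def outWeights {V : Type*} [DecidableEq V]
    (out : V → Finset V) : V → V → ℝ :=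
  fun u v => if v ∈ out u then ((out u).card : ℝ)⁻¹ else 0

/-- Extinction probability: `sup_t Pr(S_t = ∅)`. -/
noncomputable def extinctionProb {V : Type*} [Fintype V] [DecidableEq V]
    (r : ℝ) (w : V → V → ℝ) (init : Finset V → ℝ) : ℝ :=
  ⨆ t : ℕ, moranDist r w init t (∅ : Finset V)

/-- Fixation probability: `sup_t Pr(S_t = V)`. -/
noncomputable def fixationProb {V : Type*} [Fintype V] [DecidableEq V]
    (r : ℝ) (w : V → V → ℝ) (init : Finset V → ℝ) : ℝ :=
  ⨆ t : ℕ, moranDist r w init t (Finset.univ : Finset V)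

/-- Initial distribution: a single mutant at a uniformly random vertex. -/
noncomputable def uniformSingleton (V : Type*) [Fintype V] [DecidableEq V] :
    Finset V → ℝ :=
  fun S => if S.card = 1 then (Fintype.card V : ℝ)⁻¹ else 0

/-- Initial distribution: a single mutant at the fixed vertex `x₀`. -/
def pointInit {V : Type*} [DecidableEq V] (x₀ : V) : Finset V → ℝ :=
  fun S => if S = {x₀} then 1 else 0

/-- The edge weights of the counterexample evolutionary graph on three vertices:
`w(0,1) = w(0,2) = 1/2`, `w(1,0) = w(2,0) = 3/4`, `w(1,2) = w(2,1) = 1/4`, and all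
other weights `0`. -/
noncomputable def counterexampleWeights : Fin 3 → Fin 3 → ℝ :=
  ![![0, 1/2, 1/2], ![3/4, 0, 1/4], ![3/4, 1/4, 0]]

/-- Expected value of `g` after one step from `S`. -/
noncomputable def stepExp (r : ℝ) (g : Finset (Fin 3) → ℝ) (S : Finset (Fin 3)) : ℝ :=
  ∑ u : Fin 3, ∑ v : Fin 3, ((if u ∈ S then r else 1) / moranW r S) *
    counterexampleWeights u v * g (if u ∈ S then insert v S else S.erase v)

/-- Expected value of `g` after `t` steps. -/
noncomputable def distExp (r : ℝ) (g : Finset (Fin 3) → ℝ) (t : ℕ) : ℝ :=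
  ∑ S : Finset (Fin 3),
    moranDist r counterexampleWeights (uniformSingleton (Fin 3)) t S * g S

lemma sum_moranStep (r : ℝ) (g : Finset (Fin 3) → ℝ) (S : Finset (Fin 3)) :
    ∑ T, moranStep r counterexampleWeights S T * g T = stepExp r g S := by
  unfold moranStep stepExp
  simp_rw [Finset.sum_mul]
  rw [Finset.sum_comm]
  refine Finset.sum_congr rfl fun u _ => ?_
  rw [Finset.sum_comm]
  refine Finset.sum_congr rfl fun v _ => ?_
  simp_rw [mul_assoc, ite_mul, one_mul, zero_mul, mul_ite, mul_zero]
  rw [Finset.sum_ite_eq]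
  simp

lemma distExp_succ (r : ℝ) (g : Finset (Fin 3) → ℝ) (t : ℕ) :
    distExp r g (t + 1) = distExp r (stepExp r g) t := by
  unfold distExp
  simp_rw [moranDist, Finset.sum_mul]
  rw [Finset.sum_comm]
  refine Finset.sum_congr rfl fun S _ => ?_
  rw [← sum_moranStep, Finset.mul_sum]
  simp_rw [mul_assoc]

lemma moranW_eq (r : ℝ) (S : Finset (Fin 3)) :
    moranW r S = ∑ u : Fin 3, (if u ∈ S then r else 1) := by
  have h : (S.card : ℝ) = ∑ u : Fin 3, (if u ∈ S then (1 : ℝ) else 0) := by simp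
  have h3 : ((Fintype.card (Fin 3) : ℕ) : ℝ) = ∑ u : Fin 3, (1 : ℝ) := by simp
  unfold moranW
  rw [h3, h, Finset.mul_sum, ← Finset.sum_sub_distrib, ← Finset.sum_add_distrib]
  refine Finset.sum_congr rfl fun u _ => ?_
  split_ifs <;> ring

lemma moranW_pos {r : ℝ} (hr : 1 < r) (S : Finset (Fin 3)) : 0 < moranW r S := by
  rw [moranW_eq]
  refine Finset.sum_pos (fun u _ => ?_) ⟨0, by simp⟩
  split_ifs <;> linarith

lemma weights_nonneg (u v : Fin 3) : 0 ≤ counterexampleWeights u v := by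
  fin_cases u <;> fin_cases v <;> norm_num [counterexampleWeights]

lemma moranDist_nonneg {r : ℝ} (hr : 1 < r) (t : ℕ) (T : Finset (Fin 3)) :
    0 ≤ moranDist r counterexampleWeights (uniformSingleton (Fin 3)) t T := by
  induction t generalizing T with
  | zero =>
    simp only [moranDist, uniformSingleton]
    split_ifs <;> positivity
  | succ t ih =>
    simp only [moranDist]
    refine Finset.sum_nonneg fun S _ => mul_nonneg (ih S) ?_
    unfold moranStep
    refine Finset.sum_nonneg fun u _ => Finset.sum_nonneg fun v _ => ?_
    have := weights_nonneg u v
    have := moranW_pos hr S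
    refine mul_nonneg (mul_nonneg (div_nonneg ?_ this.le) ‹_›) ?_ <;> split_ifs <;> linarith

lemma distExp_mono {r : ℝ} (hr : 1 < r) {g g' : Finset (Fin 3) → ℝ} (h : ∀ S, g S ≤ g' S)
    (t : ℕ) : distExp r g t ≤ distExp r g' t :=
  Finset.sum_le_sum fun S _ => mul_le_mul_of_nonneg_left (h S) (moranDist_nonneg hr t S)

/-- Fixation probability as a function of the mutant set. -/
noncomputable def harm (r : ℝ) (S : Finset (Fin 3)) : ℝ :=
  (if 0 ∈ S then
    (if 1 ∈ S then
      (if 2 ∈ S then 4 * (r + 1) * (r ^ 2 + r + 1) else r * (2 * r + 1) * (2 * r + 3))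
     else
      (if 2 ∈ S then r * (2 * r + 1) * (2 * r + 3) else 2 * r ^ 2 * (2 * r + 1)))
   else
    (if 1 ∈ S then
      (if 2 ∈ S then r * (4 * r ^ 2 + 8 * r + 6) else r ^ 2 * (4 * r + 5))
     else
      (if 2 ∈ S then r ^ 2 * (4 * r + 5) else 0))) / (4 * (r + 1) * (r ^ 2 + r + 1))

/-- Indicator of the non-absorbed states. -/
noncomputable def transInd (S : Finset (Fin 3)) : ℝ :=
  if 0 ∈ S then (if 1 ∈ S then (if 2 ∈ S then 0 else 1) else 1)
  else (if 1 ∈ S then 1 else (if 2 ∈ S then 1 else 0))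

/-- Indicator of fixation. -/
noncomputable def fixd (S : Finset (Fin 3)) : ℝ :=
  if 0 ∈ S then (if 1 ∈ S then (if 2 ∈ S then 1 else 0) else 0) else 0

lemma stepExp_harm {r : ℝ} (hr : 1 < r) (S : Finset (Fin 3)) :
    stepExp r (harm r) S = harm r S := by
  have hQ : 4 * (r + 1) * (r ^ 2 + r + 1) ≠ 0 := by positivity
  have h1 : r + 1 + 1 ≠ 0 := by positivity
  have h2 : 1 + r + 1 ≠ 0 := by positivity
  have h3 : 1 + 1 + r ≠ 0 := by positivity
  have h4 : r + r + 1 ≠ 0 := by positivity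
  have h5 : r + 1 + r ≠ 0 := by positivity
  have h6 : 1 + r + r ≠ 0 := by positivity
  have h7 : r + r + r ≠ 0 := by positivity
  unfold stepExp
  rw [moranW_eq]
  by_cases a0 : 0 ∈ S <;> by_cases a1 : 1 ∈ S <;> by_cases a2 : 2 ∈ S <;>
    simp [Fin.sum_univ_three, counterexampleWeights, harm, a0, a1, a2] <;>
    field_simp <;> ring

lemma stepExp_trans {r : ℝ} (hr : 1 < r) (S : Finset (Fin 3)) :
    stepExp r transInd S ≤ (1 - 3 / 4 / (r + 2)) * transInd S := by
  have p1 : 0 < r + 1 + 1 := by positivity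
  have p2 : 0 < 1 + r + 1 := by positivity
  have p3 : 0 < 1 + 1 + r := by positivity
  have p4 : 0 < r + r + 1 := by positivity
  have p5 : 0 < r + 1 + r := by positivity
  have p6 : 0 < 1 + r + r := by positivity
  have p7 : 0 < r + r + r := by positivity
  have p8 : 0 < r + 2 := by positivity
  unfold stepExp
  rw [moranW_eq]
  by_cases a0 : 0 ∈ S <;> by_cases a1 : 1 ∈ S <;> by_cases a2 : 2 ∈ S <;>
    simp [Fin.sum_univ_three, counterexampleWeights, transInd, a0, a1, a2] <;>
    field_simp <;> nlinarith

lemma harm_le {r : ℝ} (hr : 1 < r) (S : Finset (Fin 3)) : harm r S ≤ fixd S + transInd S := by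
  have hQ : 0 < 4 * (r + 1) * (r ^ 2 + r + 1) := by positivity
  unfold harm fixd transInd
  rw [div_le_iff₀ hQ]
  split_ifs <;> nlinarith [pow_pos (by linarith : 0 < r) 3, pow_pos (by linarith : 0 < r) 2]

lemma le_harm {r : ℝ} (hr : 1 < r) (S : Finset (Fin 3)) : fixd S ≤ harm r S := by
  have hQ : 0 < 4 * (r + 1) * (r ^ 2 + r + 1) := by positivity
  unfold harm fixd
  rw [le_div_iff₀ hQ]
  split_ifs <;> simp <;> positivity

lemma distExp_harm {r : ℝ} (hr : 1 < r) (t : ℕ) :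
    distExp r (harm r) t = r ^ 2 / (r ^ 2 + r + 1) := by
  induction t with
  | zero =>
    have hu : (Finset.univ : Finset (Finset (Fin 3))) =
      {∅, {0}, {1}, {2}, {0, 1}, {0, 2}, {1, 2}, {0, 1, 2}} := by decide
    have h1 : r + 1 ≠ 0 := by positivity
    have h2 : r ^ 2 + r + 1 ≠ 0 := by positivity
    have : ∀ S : Finset (Fin 3), uniformSingleton (Fin 3) S * harm r S =
        if S ∈ ({{0}, {1}, {2}} : Finset (Finset (Fin 3))) then 1 / 3 * harm r S else 0 := by
      intro S
      have : S.card = 1 ↔ S ∈ ({{0}, {1}, {2}} : Finset (Finset (Fin 3))) := by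
        revert S; decide
      simp only [uniformSingleton, this]
      split_ifs <;> simp
    simp only [distExp, moranDist, this]
    rw [Finset.sum_ite_mem, Finset.univ_inter, Finset.sum_insert (by decide),
      Finset.sum_insert (by decide), Finset.sum_singleton]
    simp [harm]
    field_simp
    ring
  | succ t ih =>
    rw [distExp_succ, funext (stepExp_harm hr), ih]

lemma distExp_fixd (r : ℝ) (t : ℕ) : distExp r fixd t =
    moranDist r counterexampleWeights (uniformSingleton (Fin 3)) t Finset.univ := by
  have : ∀ S, fixd S = if S = Finset.univ then 1 else 0 := by
    intro S
    have : S = Finset.univ ↔ (0 ∈ S ∧ 1 ∈ S ∧ 2 ∈ S) := by revert S; decide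
    unfold fixd
    simp only [this]
    split_ifs <;> simp_all
  simp [distExp, this]

lemma distExp_trans {r : ℝ} (hr : 1 < r) (t : ℕ) :
    distExp r transInd t ≤ (1 - 3 / 4 / (r + 2)) ^ t * distExp r transInd 0 := by
  have h0 : 0 ≤ 1 - 3 / 4 / (r + 2) := by
    rw [sub_nonneg, div_le_one (by linarith)]; linarith
  induction t with
  | zero => simp
  | succ t ih =>
    rw [distExp_succ]
    refine (distExp_mono hr (stepExp_trans hr) t).trans ?_
    have : distExp r (fun S => (1 - 3 / 4 / (r + 2)) * transInd S) t =
        (1 - 3 / 4 / (r + 2)) * distExp r transInd t := by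
      simp only [distExp, Finset.mul_sum]
      exact Finset.sum_congr rfl fun S _ => by ring
    rw [this, pow_succ', mul_assoc]
    exact mul_le_mul_of_nonneg_left ih h0

lemma fixation_eq {r : ℝ} (hr : 1 < r) :
    fixationProb r counterexampleWeights (uniformSingleton (Fin 3)) =
      r ^ 2 / (r ^ 2 + r + 1) := by
  have hub : ∀ t, distExp r fixd t ≤ r ^ 2 / (r ^ 2 + r + 1) := fun t => by
    rw [← distExp_harm hr t]; exact distExp_mono hr (le_harm hr) t
  unfold fixationProb
  simp_rw [← distExp_fixd]
  refine le_antisymm (ciSup_le hub) ?_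
  have hlb : ∀ t, r ^ 2 / (r ^ 2 + r + 1) -
      (1 - 3 / 4 / (r + 2)) ^ t * distExp r transInd 0 ≤ ⨆ t, distExp r fixd t := fun t => by
    have h1 := distExp_mono hr (harm_le hr) t
    have h2 : distExp r (fun S => fixd S + transInd S) t = distExp r fixd t + distExp r transInd t := by
      simp only [distExp, mul_add, Finset.sum_add_distrib]
    have h3 := distExp_trans hr t
    have h4 : distExp r fixd t ≤ ⨆ t, distExp r fixd t :=
      le_ciSup (f := fun t => distExp r fixd t) ⟨_, by rintro _ ⟨t, rfl⟩; exact hub t⟩ t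
    rw [distExp_harm hr, h2] at h1
    linarith
  have h0 : 0 ≤ 1 - 3 / 4 / (r + 2) := by
    rw [sub_nonneg, div_le_one (by linarith)]; linarith
  have h1 : 1 - 3 / 4 / (r + 2) < 1 := by
    have : 0 < 3 / 4 / (r + 2) := by positivity
    linarith
  have hl := ((tendsto_pow_atTop_nhds_zero_of_lt_one h0 h1).mul_const
    (distExp r transInd 0)).const_sub (r ^ 2 / (r ^ 2 + r + 1))
  rw [zero_mul, sub_zero] at hl
  exact le_of_tendsto' hl hlb

/-- **A non-isothermal evolutionary graph with the regular fixation probability**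
(Proposition 1.12).  The weights form an evolutionary graph (all out-weights sum to 1),
it is not isothermal (indeed `w(1,0) + w(2,0) = 3/2 ≠ 1`), yet for every `r > 1` the
discrete-time Moran process with fitness `r` on it, started from a single initial mutant
at a uniformly random vertex, has fixation probability exactly `r²/(r²+r+1)`, which
equals `(1 - 1/r)/(1 - 1/r³)`. -/
theorem not_isothermal_but_regular_fixation :
    (∀ u : Fin 3, ∑ v : Fin 3, counterexampleWeights u v = 1) ∧
    counterexampleWeights 1 0 + counterexampleWeights 2 0 = 3 / 2 ∧
    ¬ (∀ v : Fin 3, ∑ u : Fin 3, counterexampleWeights u v = 1) ∧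
    ∀ r : ℝ, 1 < r →
      fixationProb r counterexampleWeights (uniformSingleton (Fin 3)) =
          r ^ 2 / (r ^ 2 + r + 1) ∧
        r ^ 2 / (r ^ 2 + r + 1) = (1 - 1 / r) / (1 - 1 / r ^ 3) := by
  refine ⟨?_, ?_, ?_, fun r hr => ⟨fixation_eq hr, ?_⟩⟩
  · intro u
    fin_cases u <;> simp [Fin.sum_univ_three, counterexampleWeights] <;> norm_num
  · simp [counterexampleWeights]
    norm_num
  · intro h
    have := h 0
    simp [Fin.sum_univ_three, counterexampleWeights] at this
    norm_num at this
  · have h1 : r ^ 3 - 1 ≠ 0 := by nlinarith [sq_nonneg r, mul_pos (by linarith : 0 < r) (by linarith : 0 < r)]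
    have h2 : r ^ 2 + r + 1 ≠ 0 := by positivity
    have h3 : r ≠ 0 := by positivity
    have h4 : 1 - 1 / r ^ 3 = (r ^ 3 - 1) / r ^ 3 := by field_simp
    rw [h4]
    field_simp
    ring
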